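/- arXiv:2204.13018 — 5 statements merged into one kernel-verified Lean document; each statement's English description precedes it below -/
import Mathlib

section
/- Let G be a finite group and let X₁, X₂, X₃ be nonempty compact metric spaces, each with an action of G by isometries. Let d₁₂ be an admissible G-invariant metric on X₁ ⊔ X₂ and d₂₃ an admissible G-invariant metric on X₂ ⊔ X₃. For ε > 0 define d₁₃ on X₁ ⊔ X₃ by letting it agree with the original metrics on X₁ and on X₃ and setting d₁₃(x₁, x₃) := inf_{x₂ ∈ X₂} ( d₁₂(x₁, x₂) + d₂₃(x₂, x₃) ) + ε for x₁ ∈ X₁, x₃ ∈ X₃. Then d₁₃ is an admissible G-invariant metric on X₁ ⊔ X₃, and the Hausdorff distance between X₁ and X₃ with respect to d₁₃ is at most the Hausdorff distance between X₁ and X₂ with respect to d₁₂ plus the Hausdorff distance between X₂ and X₃ with respect to d₂₃ plus ε. -/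
open Metric Filter

/-- An action of a monoid `G` on a metric space `X` by isometries, given by a bare
function `μ : G → X → X`. -/
def IsIsoAction {G X : Type*} [Monoid G] [MetricSpace X] (μ : G → X → X) : Prop :=
  (∀ x, μ 1 x = x) ∧ (∀ g g' x, μ (g * g') x = μ g (μ g' x)) ∧
    (∀ g x x', dist (μ g x) (μ g x') = dist x x')

/-- `d` is an admissible `G`-invariant metric on the disjoint union `X ⊔ Y`:
it restricts to the given metrics on `X` and `Y`, is symmetric, satisfies the
triangle inequality, is invariant under the diagonal `G`-action, and is strictly
positive between points of `X` and points of `Y`. -/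
def Admissible {G X Y : Type*} [MetricSpace X] [MetricSpace Y]
    (μ : G → X → X) (ν : G → Y → Y) (d : X ⊕ Y → X ⊕ Y → ℝ) : Prop :=
  (∀ a b, d a b = d b a) ∧
  (∀ a b c, d a c ≤ d a b + d b c) ∧
  (∀ x x' : X, d (Sum.inl x) (Sum.inl x') = dist x x') ∧
  (∀ y y' : Y, d (Sum.inr y) (Sum.inr y') = dist y y') ∧
  (∀ (g : G) (a b : X ⊕ Y), d (Sum.map (μ g) (ν g) a) (Sum.map (μ g) (ν g) b) = d a b) ∧
  (∀ (x : X) (y : Y), 0 < d (Sum.inl x) (Sum.inr y))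

/-- The Hausdorff distance between `X` and `Y` inside `(X ⊔ Y, d)`. -/
noncomputable def hDist {X Y : Type*} (d : X ⊕ Y → X ⊕ Y → ℝ) : ℝ :=
  max (⨆ x : X, ⨅ y : Y, d (Sum.inl x) (Sum.inr y))
      (⨆ y : Y, ⨅ x : X, d (Sum.inl x) (Sum.inr y))

/-- The `G`-equivariant Gromov--Hausdorff distance: the infimum over all admissible
`G`-invariant metrics on `X ⊔ Y` of the Hausdorff distance between `X` and `Y`. -/
noncomputable def eqGHDist (G : Type*) {X Y : Type*} [MetricSpace X] [MetricSpace Y]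
    (μ : G → X → X) (ν : G → Y → Y) : ℝ :=
  sInf (hDist '' {d | Admissible μ ν d})

/-- Given metrics `d12` on `X₁ ⊔ X₂` and `d23` on `X₂ ⊔ X₃` and `ε > 0`, the glued
candidate metric on `X₁ ⊔ X₃`: it agrees with the original metrics on `X₁` and `X₃`,
and between `x₁ ∈ X₁` and `x₃ ∈ X₃` it is
`inf_{x₂ ∈ X₂} (d12 x₁ x₂ + d23 x₂ x₃) + ε`. -/
noncomputable def glueMetric {X₁ X₂ X₃ : Type*} [MetricSpace X₁] [MetricSpace X₃]
    (d12 : X₁ ⊕ X₂ → X₁ ⊕ X₂ → ℝ) (d23 : X₂ ⊕ X₃ → X₂ ⊕ X₃ → ℝ) (ε : ℝ) :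
    X₁ ⊕ X₃ → X₁ ⊕ X₃ → ℝ
  | Sum.inl x, Sum.inl x' => dist x x'
  | Sum.inr z, Sum.inr z' => dist z z'
  | Sum.inl x, Sum.inr z =>
      (⨅ y : X₂, d12 (Sum.inl x) (Sum.inr y) + d23 (Sum.inl y) (Sum.inr z)) + ε
  | Sum.inr z, Sum.inl x =>
      (⨅ y : X₂, d12 (Sum.inl x) (Sum.inr y) + d23 (Sum.inl y) (Sum.inr z)) + ε

theorem IsIsoAction.surjective {G X : Type*} [Group G] [MetricSpace X] {μ : G → X → X}
    (hμ : IsIsoAction μ) (g : G) : Function.Surjective (μ g) := fun x =>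
  ⟨μ g⁻¹ x, by rw [← hμ.2.1, mul_inv_cancel, hμ.1]⟩

namespace Admissible

variable {G X Y : Type*} [MetricSpace X] [MetricSpace Y]
  {μ : G → X → X} {ν : G → Y → Y} {d : X ⊕ Y → X ⊕ Y → ℝ}

theorem bddBelow_range_right (h : Admissible μ ν d) (x : X) :
    BddBelow (Set.range fun y : Y => d (Sum.inl x) (Sum.inr y)) :=
  ⟨0, by rintro _ ⟨y, rfl⟩; exact (h.2.2.2.2.2 x y).le⟩

theorem bddBelow_range_left (h : Admissible μ ν d) (y : Y) :
    BddBelow (Set.range fun x : X => d (Sum.inl x) (Sum.inr y)) :=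
  ⟨0, by rintro _ ⟨x, rfl⟩; exact (h.2.2.2.2.2 x y).le⟩

theorem exists_right_lt_of_hDist_lt [CompactSpace X] [Nonempty Y]
    (h : Admissible μ ν d) {r : ℝ} (hr : hDist d < r) (x : X) :
    ∃ y : Y, d (Sum.inl x) (Sum.inr y) < r := by
  obtain ⟨y₀⟩ := ‹Nonempty Y›
  have hb : BddAbove (Set.range fun x : X => ⨅ y : Y, d (Sum.inl x) (Sum.inr y)) := by
    refine ⟨Metric.diam (Set.univ : Set X) + d (Sum.inl x) (Sum.inr y₀), ?_⟩
    rintro _ ⟨x', rfl⟩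
    have h₁ := ciInf_le (h.bddBelow_range_right x') y₀
    have h₂ := h.2.1 (Sum.inl x') (Sum.inl x) (Sum.inr y₀)
    have h₃ := Metric.dist_le_diam_of_mem isCompact_univ.isBounded
      (Set.mem_univ x') (Set.mem_univ x)
    rw [h.2.2.1] at h₂
    dsimp only at h₁ ⊢
    linarith
  have : Nonempty Y := ⟨y₀⟩
  exact exists_lt_of_ciInf_lt (((le_ciSup hb x).trans (le_max_left _ _)).trans_lt hr)

theorem exists_left_lt_of_hDist_lt [CompactSpace Y] [Nonempty X]
    (h : Admissible μ ν d) {r : ℝ} (hr : hDist d < r) (y : Y) :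
    ∃ x : X, d (Sum.inl x) (Sum.inr y) < r := by
  obtain ⟨x₀⟩ := ‹Nonempty X›
  have hb : BddAbove (Set.range fun y : Y => ⨅ x : X, d (Sum.inl x) (Sum.inr y)) := by
    refine ⟨d (Sum.inl x₀) (Sum.inr y) + Metric.diam (Set.univ : Set Y), ?_⟩
    rintro _ ⟨y', rfl⟩
    have h₁ := ciInf_le (h.bddBelow_range_left y') x₀
    have h₂ := h.2.1 (Sum.inl x₀) (Sum.inr y) (Sum.inr y')
    have h₃ := Metric.dist_le_diam_of_mem isCompact_univ.isBounded
      (Set.mem_univ y) (Set.mem_univ y')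
    rw [h.2.2.2.1] at h₂
    dsimp only at h₁ ⊢
    linarith
  have : Nonempty X := ⟨x₀⟩
  exact exists_lt_of_ciInf_lt (((le_ciSup hb y).trans (le_max_right _ _)).trans_lt hr)

theorem hDist_le [Nonempty X] [Nonempty Y] (h : Admissible μ ν d) {r : ℝ}
    (hX : ∀ x, ∃ y, d (Sum.inl x) (Sum.inr y) ≤ r)
    (hY : ∀ y, ∃ x, d (Sum.inl x) (Sum.inr y) ≤ r) : hDist d ≤ r := by
  refine max_le (ciSup_le fun x => ?_) (ciSup_le fun y => ?_)
  · obtain ⟨y, hy⟩ := hX x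
    exact (ciInf_le (h.bddBelow_range_right x) y).trans hy
  · obtain ⟨x, hx⟩ := hY y
    exact (ciInf_le (h.bddBelow_range_left y) x).trans hx

end Admissible

section Glue

variable {G X₁ X₂ X₃ : Type*} [MetricSpace X₁] [MetricSpace X₃]
  {d12 : X₁ ⊕ X₂ → X₁ ⊕ X₂ → ℝ} {d23 : X₂ ⊕ X₃ → X₂ ⊕ X₃ → ℝ} {ε : ℝ}

theorem glueMetric_comm (a b : X₁ ⊕ X₃) :
    glueMetric d12 d23 ε a b = glueMetric d12 d23 ε b a := by
  rcases a with x | z <;> rcases b with x' | z' <;> simp only [glueMetric, dist_comm]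

theorem le_glueMetric_inl_inr [Nonempty X₂] {x : X₁} {z : X₃} {c : ℝ}
    (h : ∀ y : X₂, c ≤ d12 (Sum.inl x) (Sum.inr y) + d23 (Sum.inl y) (Sum.inr z) + ε) :
    c ≤ glueMetric d12 d23 ε (Sum.inl x) (Sum.inr z) :=
  sub_le_iff_le_add.1 (le_ciInf fun y => sub_le_iff_le_add.2 (h y))

variable [MetricSpace X₂]
  {μ₁ : G → X₁ → X₁} {μ₂ : G → X₂ → X₂} {μ₃ : G → X₃ → X₃}

theorem glueMetric_inl_inr_le (h12 : Admissible μ₁ μ₂ d12) (h23 : Admissible μ₂ μ₃ d23)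
    (x : X₁) (y : X₂) (z : X₃) :
    glueMetric d12 d23 ε (Sum.inl x) (Sum.inr z) ≤
      d12 (Sum.inl x) (Sum.inr y) + d23 (Sum.inl y) (Sum.inr z) + ε := by
  refine add_le_add_left (ciInf_le ⟨0, ?_⟩ y) ε
  rintro _ ⟨y, rfl⟩
  exact (add_pos (h12.2.2.2.2.2 x y) (h23.2.2.2.2.2 y z)).le

theorem glueMetric_inl_inr_le_dist_left_add [Nonempty X₂]
    (h12 : Admissible μ₁ μ₂ d12) (h23 : Admissible μ₂ μ₃ d23) (x x' : X₁) (z : X₃) :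
    glueMetric d12 d23 ε (Sum.inl x) (Sum.inr z) ≤
      dist x x' + glueMetric d12 d23 ε (Sum.inl x') (Sum.inr z) := by
  refine sub_le_iff_le_add'.1 (le_glueMetric_inl_inr fun y => ?_)
  have h₁ := glueMetric_inl_inr_le (ε := ε) h12 h23 x y z
  have h₂ := h12.2.1 (Sum.inl x) (Sum.inl x') (Sum.inr y)
  rw [h12.2.2.1] at h₂
  linarith

theorem glueMetric_inl_inr_le_add_dist_right [Nonempty X₂]
    (h12 : Admissible μ₁ μ₂ d12) (h23 : Admissible μ₂ μ₃ d23) (x : X₁) (z z' : X₃) :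
    glueMetric d12 d23 ε (Sum.inl x) (Sum.inr z') ≤
      glueMetric d12 d23 ε (Sum.inl x) (Sum.inr z) + dist z z' := by
  refine sub_le_iff_le_add.1 (le_glueMetric_inl_inr fun y => ?_)
  have h₁ := glueMetric_inl_inr_le (ε := ε) h12 h23 x y z'
  have h₂ := h23.2.1 (Sum.inl y) (Sum.inr z) (Sum.inr z')
  rw [h23.2.2.2.1] at h₂
  linarith

theorem dist_left_le_glueMetric_add [Nonempty X₂] (hε : 0 ≤ ε)
    (h12 : Admissible μ₁ μ₂ d12) (h23 : Admissible μ₂ μ₃ d23) (x x' : X₁) (z : X₃) :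
    dist x x' ≤ glueMetric d12 d23 ε (Sum.inl x) (Sum.inr z) +
      glueMetric d12 d23 ε (Sum.inl x') (Sum.inr z) := by
  refine sub_le_iff_le_add.1 (le_glueMetric_inl_inr fun y => ?_)
  refine sub_le_comm.1 (le_glueMetric_inl_inr fun y' => ?_)
  have h₁ := h12.2.1 (Sum.inl x) (Sum.inr y) (Sum.inl x')
  have h₂ := h12.2.1 (Sum.inr y) (Sum.inr y') (Sum.inl x')
  have h₃ := h23.2.1 (Sum.inl y) (Sum.inr z) (Sum.inl y')
  rw [h12.2.2.1] at h₁
  rw [h12.2.2.2.1, h12.1 (Sum.inr y') (Sum.inl x')] at h₂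
  rw [h23.2.2.1, h23.1 (Sum.inr z) (Sum.inl y')] at h₃
  linarith

theorem dist_right_le_glueMetric_add [Nonempty X₂] (hε : 0 ≤ ε)
    (h12 : Admissible μ₁ μ₂ d12) (h23 : Admissible μ₂ μ₃ d23) (x : X₁) (z z' : X₃) :
    dist z z' ≤ glueMetric d12 d23 ε (Sum.inl x) (Sum.inr z) +
      glueMetric d12 d23 ε (Sum.inl x) (Sum.inr z') := by
  refine sub_le_iff_le_add.1 (le_glueMetric_inl_inr fun y => ?_)
  refine sub_le_comm.1 (le_glueMetric_inl_inr fun y' => ?_)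
  have h₁ := h23.2.1 (Sum.inr z) (Sum.inl y) (Sum.inr z')
  have h₂ := h23.2.1 (Sum.inl y) (Sum.inl y') (Sum.inr z')
  have h₃ := h12.2.1 (Sum.inr y) (Sum.inl x) (Sum.inr y')
  rw [h23.2.2.2.1, h23.1 (Sum.inr z) (Sum.inl y)] at h₁
  rw [h23.2.2.1] at h₂
  rw [h12.2.2.2.1, h12.1 (Sum.inr y) (Sum.inl x)] at h₃
  linarith

theorem glueMetric_triangle [Nonempty X₂] (hε : 0 ≤ ε)
    (h12 : Admissible μ₁ μ₂ d12) (h23 : Admissible μ₂ μ₃ d23) (a b c : X₁ ⊕ X₃) :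
    glueMetric d12 d23 ε a c ≤ glueMetric d12 d23 ε a b + glueMetric d12 d23 ε b c := by
  rcases a with x | z <;> rcases b with x' | z' <;> rcases c with x'' | z''
  · exact dist_triangle x x' x''
  · exact glueMetric_inl_inr_le_dist_left_add h12 h23 x x' z''
  · exact dist_left_le_glueMetric_add hε h12 h23 x x'' z'
  · exact glueMetric_inl_inr_le_add_dist_right h12 h23 x z' z''
  · have h := glueMetric_inl_inr_le_dist_left_add (ε := ε) h12 h23 x'' x' z
    rw [dist_comm, add_comm] at h
    exact h
  · exact dist_right_le_glueMetric_add hε h12 h23 x' z z''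
  · have h := glueMetric_inl_inr_le_add_dist_right (ε := ε) h12 h23 x'' z' z
    rw [dist_comm, add_comm] at h
    exact h
  · exact dist_triangle z z' z''

theorem glueMetric_map_inl_inr [Group G] (hμ₂ : IsIsoAction μ₂)
    (h12 : Admissible μ₁ μ₂ d12) (h23 : Admissible μ₂ μ₃ d23) (g : G) (x : X₁) (z : X₃) :
    glueMetric d12 d23 ε (Sum.inl (μ₁ g x)) (Sum.inr (μ₃ g z)) =
      glueMetric d12 d23 ε (Sum.inl x) (Sum.inr z) := by
  refine congrArg (· + ε) ((hμ₂.surjective g).iInf_congr _ fun y => ?_).symm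
  exact congrArg₂ (· + ·) (h12.2.2.2.2.1 g (Sum.inl x) (Sum.inr y))
    (h23.2.2.2.2.1 g (Sum.inl y) (Sum.inr z))

theorem admissible_glueMetric [Group G] [Nonempty X₂] (hε : 0 < ε)
    (hμ₁ : IsIsoAction μ₁) (hμ₂ : IsIsoAction μ₂) (hμ₃ : IsIsoAction μ₃)
    (h12 : Admissible μ₁ μ₂ d12) (h23 : Admissible μ₂ μ₃ d23) :
    Admissible μ₁ μ₃ (glueMetric d12 d23 ε) := by
  refine ⟨glueMetric_comm, glueMetric_triangle hε.le h12 h23, fun _ _ => rfl, fun _ _ => rfl,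
    ?_, fun x z => hε.trans_le (le_glueMetric_inl_inr fun y => ?_)⟩
  · rintro g (x | z) (x' | z')
    · exact hμ₁.2.2 g x x'
    · exact glueMetric_map_inl_inr hμ₂ h12 h23 g x z'
    · exact glueMetric_map_inl_inr hμ₂ h12 h23 g x' z
    · exact hμ₃.2.2 g z z'
  · exact le_add_of_nonneg_left (add_pos (h12.2.2.2.2.2 x y) (h23.2.2.2.2.2 y z)).le

end Glue

/-- The glued metric `d₁₃` on `X₁ ⊔ X₃` is an admissible `G`-invariant
metric, and the Hausdorff distance between `X₁` and `X₃` with respect to it is at most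
the sum of the Hausdorff distances for `d₁₂` and `d₂₃` plus `ε`. -/
theorem stmt1 (G : Type*) [Group G] [Fintype G]
    (X₁ X₂ X₃ : Type*) [MetricSpace X₁] [MetricSpace X₂] [MetricSpace X₃]
    [CompactSpace X₁] [CompactSpace X₂] [CompactSpace X₃]
    [Nonempty X₁] [Nonempty X₂] [Nonempty X₃]
    (μ₁ : G → X₁ → X₁) (μ₂ : G → X₂ → X₂) (μ₃ : G → X₃ → X₃)
    (hμ₁ : IsIsoAction μ₁) (hμ₂ : IsIsoAction μ₂) (hμ₃ : IsIsoAction μ₃)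
    (d12 : X₁ ⊕ X₂ → X₁ ⊕ X₂ → ℝ) (d23 : X₂ ⊕ X₃ → X₂ ⊕ X₃ → ℝ)
    (h12 : Admissible μ₁ μ₂ d12) (h23 : Admissible μ₂ μ₃ d23)
    (ε : ℝ) (hε : 0 < ε) :
    Admissible μ₁ μ₃ (glueMetric d12 d23 ε) ∧
      hDist (glueMetric d12 d23 ε) ≤ hDist d12 + hDist d23 + ε := by
  have h13 := admissible_glueMetric hε hμ₁ hμ₂ hμ₃ h12 h23
  refine ⟨h13, le_of_forall_pos_le_add fun δ hδ => ?_⟩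
  have hr12 : hDist d12 < hDist d12 + δ / 2 := lt_add_of_pos_right _ (half_pos hδ)
  have hr23 : hDist d23 < hDist d23 + δ / 2 := lt_add_of_pos_right _ (half_pos hδ)
  refine h13.hDist_le (fun x => ?_) (fun z => ?_)
  · obtain ⟨y, hy⟩ := h12.exists_right_lt_of_hDist_lt hr12 x
    obtain ⟨z, hz⟩ := h23.exists_right_lt_of_hDist_lt hr23 y
    exact ⟨z, (glueMetric_inl_inr_le h12 h23 x y z).trans (by linarith)⟩
  · obtain ⟨y, hy⟩ := h23.exists_left_lt_of_hDist_lt hr23 z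
    obtain ⟨x, hx⟩ := h12.exists_left_lt_of_hDist_lt hr12 y
    exact ⟨x, (glueMetric_inl_inr_le h12 h23 x y z).trans (by linarith)⟩
end

section
/- Let G be a finite group and let X and Y be nonempty compact metric spaces, each with an action of G by isometries. Then d^G_GH(X,Y) = 0 if and only if there exists a G-equivariant isometry from X onto Y, i.e. a bijection f : X → Y such that dist(f(x), f(x')) = dist(x, x') for all x, x' ∈ X and f(g·x) = g·f(x) for all g ∈ G and x ∈ X. -/
open Metric Filter

theorem eqGHDist_nonneg {G X Y : Type*} [MetricSpace X] [MetricSpace Y]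
    (μ : G → X → X) (ν : G → Y → Y) : 0 ≤ eqGHDist G μ ν := by
  refine Real.sInf_nonneg ?_
  rintro _ ⟨d, ⟨-, -, -, -, -, hpos⟩, rfl⟩
  exact le_max_of_le_left
    (Real.iSup_nonneg fun x => Real.iInf_nonneg fun y => (hpos x y).le)

/-- The symmetric extension to `X ⊔ Y` of a function on `X × Y`. -/
def glueCross {X Y : Type*} [MetricSpace X] [MetricSpace Y] (c : X → Y → ℝ) :
    X ⊕ Y → X ⊕ Y → ℝ
  | Sum.inl x, Sum.inl x' => dist x x'
  | Sum.inr y, Sum.inr y' => dist y y'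
  | Sum.inl x, Sum.inr y => c x y
  | Sum.inr y, Sum.inl x => c x y

theorem admissible_glueCross {G X Y : Type*} [Monoid G] [MetricSpace X] [MetricSpace Y]
    {μ : G → X → X} {ν : G → Y → Y} (hμ : IsIsoAction μ) (hν : IsIsoAction ν) {c : X → Y → ℝ}
    (hpos : ∀ x y, 0 < c x y) (hinv : ∀ g x y, c (μ g x) (ν g y) = c x y)
    (hX : ∀ x x' y, c x y ≤ dist x x' + c x' y) (hY : ∀ x y y', c x y ≤ c x y' + dist y' y)
    (hX' : ∀ x x' y, dist x x' ≤ c x y + c x' y) (hY' : ∀ x y y', dist y y' ≤ c x y + c x y') :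
    Admissible μ ν (glueCross c) := by
  refine ⟨?_, ?_, fun _ _ => rfl, fun _ _ => rfl, ?_, hpos⟩
  · rintro (a | a) (b | b) <;> simp [glueCross, dist_comm]
  · rintro (a | a) (b | b) (e | e) <;> simp only [glueCross]
    · exact dist_triangle _ _ _
    · exact hX _ _ _
    · exact hX' _ _ _
    · exact hY _ _ _
    · linarith [hX e b a, dist_comm e b]
    · exact hY' _ _ _
    · linarith [hY e a b, dist_comm a b]
    · exact dist_triangle _ _ _
  · rintro g (a | a) (b | b) <;> simp [glueCross, hinv, hμ.2.2, hν.2.2]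

theorem exists_admissible {G X Y : Type*} [Monoid G] [MetricSpace X] [MetricSpace Y]
    [CompactSpace X] [CompactSpace Y] {μ : G → X → X} {ν : G → Y → Y}
    (hμ : IsIsoAction μ) (hν : IsIsoAction ν) :
    ∃ d : X ⊕ Y → X ⊕ Y → ℝ, Admissible μ ν d := by
  have hX : ∀ x x' : X, dist x x' ≤ diam (Set.univ : Set X) := fun x x' =>
    dist_le_diam_of_mem isCompact_univ.isBounded trivial trivial
  have hY : ∀ y y' : Y, dist y y' ≤ diam (Set.univ : Set Y) := fun y y' =>
    dist_le_diam_of_mem isCompact_univ.isBounded trivial trivial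
  have hX0 : 0 ≤ diam (Set.univ : Set X) := diam_nonneg
  have hY0 : 0 ≤ diam (Set.univ : Set Y) := diam_nonneg
  refine ⟨_, admissible_glueCross hμ hν
    (c := fun _ _ => diam (Set.univ : Set X) + diam (Set.univ : Set Y) + 1)
    (fun _ _ => by positivity) (fun _ _ _ => rfl) (fun x x' _ => ?_) (fun _ y y' => ?_)
    (fun x x' _ => ?_) (fun _ y y' => ?_)⟩
  · exact le_add_of_nonneg_left dist_nonneg
  · exact le_add_of_nonneg_right dist_nonneg
  · linarith [hX x x']
  · linarith [hY y y']

theorem eqGHDist_eq_zero_of_equivariant_isometry {G X Y : Type*} [Monoid G]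
    [MetricSpace X] [MetricSpace Y] [Nonempty X] {μ : G → X → X} {ν : G → Y → Y}
    (hμ : IsIsoAction μ) (hν : IsIsoAction ν) {f : X → Y} (hsurj : Function.Surjective f)
    (hf : ∀ x x', dist (f x) (f x') = dist x x') (hfeq : ∀ g x, f (μ g x) = ν g (f x)) :
    eqGHDist G μ ν = 0 := by
  refine le_antisymm (le_of_forall_pos_le_add fun ε hε => ?_) (eqGHDist_nonneg μ ν)
  have hadm : Admissible μ ν (glueCross fun x y => dist (f x) y + ε) := by
    refine admissible_glueCross hμ hν (fun x y => by positivity)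
      (fun g x y => by rw [hfeq, hν.2.2]) (fun x x' y => ?_) (fun x y y' => ?_)
      (fun x x' y => ?_) (fun x y y' => ?_)
    · linarith [dist_triangle (f x) (f x') y, hf x x']
    · linarith [dist_triangle (f x) y' y]
    · linarith [dist_triangle_right (f x) (f x') y, hf x x']
    · linarith [dist_triangle_left y y' (f x)]
  have hbdd : BddBelow (hDist '' {d : X ⊕ Y → X ⊕ Y → ℝ | Admissible μ ν d}) := by
    refine ⟨0, ?_⟩
    rintro _ ⟨d, ⟨-, -, -, -, -, hpos⟩, rfl⟩
    exact le_max_of_le_left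
      (Real.iSup_nonneg fun x => Real.iInf_nonneg fun y => (hpos x y).le)
  rw [zero_add]
  refine (csInf_le hbdd ⟨_, hadm, rfl⟩).trans (max_le ?_ ?_)
  · refine ciSup_le fun x => (ciInf_le ⟨0, ?_⟩ (f x)).trans (by simp [glueCross])
    rintro _ ⟨y, rfl⟩
    exact (hadm.2.2.2.2.2 x y).le
  · have : Nonempty Y := ‹Nonempty X›.map f
    refine ciSup_le fun y => ?_
    obtain ⟨x, rfl⟩ := hsurj y
    refine (ciInf_le ⟨0, ?_⟩ x).trans (by simp [glueCross])
    rintro _ ⟨x', rfl⟩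
    exact (hadm.2.2.2.2.2 x' (f x)).le

namespace Admissible

variable {G X Y : Type*} [MetricSpace X] [MetricSpace Y] {μ : G → X → X} {ν : G → Y → Y}
  {d : X ⊕ Y → X ⊕ Y → ℝ}

theorem exists_lt_of_hDist_lt_left [CompactSpace X] [Nonempty Y] (hd : Admissible μ ν d) {ε : ℝ}
    (h : hDist d < ε) (x : X) : ∃ y, d (Sum.inl x) (Sum.inr y) < ε := by
  refine exists_lt_of_ciInf_lt (lt_of_le_of_lt ?_ ((le_max_left _ _).trans_lt h))
  obtain ⟨y₀⟩ := ‹Nonempty Y›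
  refine le_ciSup (f := fun x => ⨅ y, d (Sum.inl x) (Sum.inr y))
    ⟨diam (Set.univ : Set X) + d (Sum.inl x) (Sum.inr y₀), ?_⟩ x
  rintro _ ⟨x', rfl⟩
  refine (ciInf_le ⟨0, ?_⟩ y₀).trans ?_
  · rintro _ ⟨y, rfl⟩
    exact (hd.2.2.2.2.2 x' y).le
  · refine (hd.2.1 _ (Sum.inl x) _).trans (add_le_add_left ?_ _)
    rw [hd.2.2.1]
    exact dist_le_diam_of_mem isCompact_univ.isBounded trivial trivial

theorem exists_lt_of_hDist_lt_right [CompactSpace Y] [Nonempty X] (hd : Admissible μ ν d) {ε : ℝ}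
    (h : hDist d < ε) (y : Y) : ∃ x, d (Sum.inl x) (Sum.inr y) < ε := by
  refine exists_lt_of_ciInf_lt (lt_of_le_of_lt ?_ ((le_max_right _ _).trans_lt h))
  obtain ⟨x₀⟩ := ‹Nonempty X›
  refine le_ciSup (f := fun y => ⨅ x, d (Sum.inl x) (Sum.inr y))
    ⟨d (Sum.inl x₀) (Sum.inr y) + diam (Set.univ : Set Y), ?_⟩ y
  rintro _ ⟨y', rfl⟩
  refine (ciInf_le ⟨0, ?_⟩ x₀).trans ?_
  · rintro _ ⟨x, rfl⟩
    exact (hd.2.2.2.2.2 x y').le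
  · refine (hd.2.1 _ (Sum.inr y) _).trans (add_le_add_right ?_ _)
    rw [hd.2.2.2.1]
    exact dist_le_diam_of_mem isCompact_univ.isBounded trivial trivial

theorem abs_dist_sub_dist_le (hd : Admissible μ ν d) {ε : ℝ} {x x' : X} {y y' : Y}
    (h : d (Sum.inl x) (Sum.inr y) < ε) (h' : d (Sum.inl x') (Sum.inr y') < ε) :
    |dist y y' - dist x x'| ≤ 2 * ε := by
  obtain ⟨hsymm, htri, hX, hY, -, -⟩ := hd
  rw [abs_le, ← hX, ← hY]
  constructor
  · linarith [htri (Sum.inl x) (Sum.inr y) (Sum.inl x'), htri (Sum.inr y) (Sum.inr y') (Sum.inl x'),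
      hsymm (Sum.inr y') (Sum.inl x')]
  · linarith [htri (Sum.inr y) (Sum.inl x) (Sum.inr y'), htri (Sum.inl x) (Sum.inl x') (Sum.inr y'),
      hsymm (Sum.inr y) (Sum.inl x)]

end Admissible

/-- Vanishing equivariant Gromov--Hausdorff distance yields almost isometric, almost equivariant
maps which are almost inverse to each other. -/
theorem exists_almost_isometry_of_eqGHDist_eq_zero {G X Y : Type*} [Monoid G]
    [MetricSpace X] [MetricSpace Y] [CompactSpace X] [CompactSpace Y] [Nonempty X] [Nonempty Y]
    {μ : G → X → X} {ν : G → Y → Y} (hμ : IsIsoAction μ) (hν : IsIsoAction ν)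
    (h : eqGHDist G μ ν = 0) {ε : ℝ} (hε : 0 < ε) :
    ∃ (f : X → Y) (k : Y → X), (∀ x x', |dist (f x) (f x') - dist x x'| ≤ 2 * ε) ∧
      (∀ g x, dist (f (μ g x)) (ν g (f x)) ≤ 2 * ε) ∧ ∀ y, dist (f (k y)) y ≤ 2 * ε := by
  obtain ⟨d₀, hd₀⟩ := exists_admissible (X := X) (Y := Y) hμ hν
  obtain ⟨_, ⟨d, hd, rfl⟩, hlt⟩ := exists_lt_of_csInf_lt
    (s := hDist '' {d : X ⊕ Y → X ⊕ Y → ℝ | Admissible μ ν d})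
    ⟨_, d₀, hd₀, rfl⟩ (h.trans_lt hε)
  choose f hf using hd.exists_lt_of_hDist_lt_left hlt
  choose k hk using hd.exists_lt_of_hDist_lt_right hlt
  refine ⟨f, k, fun x x' => hd.abs_dist_sub_dist_le (hf x) (hf x'), fun g x => ?_, fun y => ?_⟩
  · have hg : d (Sum.inl (μ g x)) (Sum.inr (ν g (f x))) < ε :=
      (hd.2.2.2.2.1 g (Sum.inl x) (Sum.inr (f x))).trans_lt (hf x)
    simpa using hd.abs_dist_sub_dist_le (hf (μ g x)) hg
  · simpa using hd.abs_dist_sub_dist_le (hf (k y)) (hk y)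

/-- For nonempty compact metric spaces with `G`-actions by isometries,
the `G`-equivariant Gromov--Hausdorff distance vanishes if and only if there is a
`G`-equivariant bijective isometry `X → Y`. -/
theorem stmt3 (G : Type*) [Group G] [Fintype G]
    (X Y : Type*) [MetricSpace X] [MetricSpace Y]
    [CompactSpace X] [CompactSpace Y] [Nonempty X] [Nonempty Y]
    (μ : G → X → X) (ν : G → Y → Y)
    (hμ : IsIsoAction μ) (hν : IsIsoAction ν) :
    eqGHDist G μ ν = 0 ↔
      ∃ f : X → Y, Function.Bijective f ∧
        (∀ x x' : X, dist (f x) (f x') = dist x x') ∧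
        (∀ (g : G) (x : X), f (μ g x) = ν g (f x)) := by
  refine ⟨fun h => ?_, fun ⟨f, hf, hiso, heq⟩ =>
    eqGHDist_eq_zero_of_equivariant_isometry hμ hν hf.surjective hiso heq⟩
  choose f k hf hfeq hfk using fun n : ℕ => exists_almost_isometry_of_eqGHDist_eq_zero hμ hν h
    (Nat.one_div_pos_of_nat (α := ℝ) (n := n))
  have hε : Tendsto (fun n : ℕ => 2 * (1 / ((n : ℝ) + 1))) (hyperfilter ℕ) (nhds 0) := by
    simpa using ((tendsto_one_div_add_atTop_nhds_zero_nat (𝕜 := ℝ)).const_mul 2).mono_left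
      Nat.hyperfilter_le_atTop
  have hlimY (x : X) : ∃ y, Tendsto (fun n => f n x) (hyperfilter ℕ) (nhds y) :=
    ⟨_, ((hyperfilter ℕ).map fun n => f n x).le_nhds_lim⟩
  have hlimX (y : Y) : ∃ x, Tendsto (fun n => k n y) (hyperfilter ℕ) (nhds x) :=
    ⟨_, ((hyperfilter ℕ).map fun n => k n y).le_nhds_lim⟩
  choose F hF using hlimY
  choose K hK using hlimX
  have hiso (x x' : X) : dist (F x) (F x') = dist x x' := by
    refine tendsto_nhds_unique ((hF x).dist (hF x')) ?_
    rw [tendsto_iff_dist_tendsto_zero]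
    exact squeeze_zero (fun _ => dist_nonneg) (fun n => hf n x x') hε
  refine ⟨F, ⟨fun x x' hxx' => ?_, fun y => ⟨K y, ?_⟩⟩, hiso, fun g x => ?_⟩
  · rw [← dist_eq_zero, ← hiso, hxx', dist_self]
  · refine tendsto_nhds_unique (hF (K y)) ?_
    rw [tendsto_iff_dist_tendsto_zero]
    have hbound (n : ℕ) : dist (f n (K y)) y ≤
        dist (k n y) (K y) + 2 * (1 / ((n : ℝ) + 1)) + 2 * (1 / ((n : ℝ) + 1)) := by
      linarith [dist_triangle (f n (K y)) (f n (k n y)) y, hfk n y,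
        (abs_le.1 (hf n (K y) (k n y))).2, dist_comm (k n y) (K y)]
    refine squeeze_zero (fun _ => dist_nonneg) hbound ?_
    simpa using ((tendsto_iff_dist_tendsto_zero.1 (hK y)).add hε).add hε
  · have hcont : Continuous (ν g) := (Isometry.of_dist_eq (hν.2.2 g)).continuous
    refine dist_eq_zero.1 (le_antisymm ?_ dist_nonneg)
    exact le_of_tendsto_of_tendsto'
      ((hF (μ g x)).dist ((hcont.tendsto (F x)).comp (hF x))) hε fun n => hfeq n g x
end

section
/- Let G be a finite group and for each i ∈ ℕ let Xᵢ be a nonempty compact metric space equipped with an action of G by isometries. Assume that the sequence (Xᵢ) converges in the Gromov–Hausdorff distance to some nonempty compact metric space W, i.e. the Gromov–Hausdorff distance between Xᵢ and W tends to 0. Then there exist a nonempty compact metric space X equipped with an action of G by isometries, a strictly increasing function φ : ℕ → ℕ, and for each i an admissible G-invariant metric dᵢ on X_{φ(i)} ⊔ X, such that the Hausdorff distance between X_{φ(i)} and X with respect to dᵢ tends to 0 as i → ∞. (Equivalently: the forgetful map from the space of compact metric G-spaces with the G-equivariant Gromov–Hausdorff distance to the Gromov–Hausdorff space is proper.) 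-/
open Metric Filter

/-- Cross distances between the points of two metric spaces, as given by a pseudometric on the
disjoint union extending both metrics, for which the two spaces are at Hausdorff distance less
than `ε`. -/
structure IsCrossDist {X Y : Type*} [MetricSpace X] [MetricSpace Y] (D : X → Y → ℝ) (ε : ℝ) :
    Prop where
  nonneg : ∀ x y, 0 ≤ D x y
  dist_left_le : ∀ x x' y, dist x x' ≤ D x y + D x' y
  dist_right_le : ∀ x y y', dist y y' ≤ D x y + D x y'
  le_left : ∀ x x' y, D x y ≤ dist x x' + D x' y
  le_right : ∀ x y y', D x y ≤ D x y' + dist y' y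
  exists_right : ∀ x, ∃ y, D x y < ε
  exists_left : ∀ y, ∃ x, D x y < ε

/-- A cross distance realizing a bound on the Gromov-Hausdorff distance, transported along an
isometry of the second space. -/
theorem exists_isCrossDist (X W Z : Type*) [MetricSpace X] [CompactSpace X] [Nonempty X]
    [MetricSpace W] [CompactSpace W] [Nonempty W] [MetricSpace Z] (e : Z ≃ᵢ W)
    {ε : ℝ} (h : GromovHausdorff.ghDist X W < ε) :
    ∃ D : X → Z → ℝ, IsCrossDist D ε := by
  obtain ⟨Φ, Ψ, hΦ, hΨ, hd⟩ := GromovHausdorff.ghDist_eq_hausdorffDist X W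
  rw [hd] at h
  have hfin : Metric.hausdorffEDist (Set.range Φ) (Set.range Ψ) ≠ ⊤ :=
    Metric.hausdorffEDist_ne_top_of_nonempty_of_bounded (Set.range_nonempty _)
      (Set.range_nonempty _) (isCompact_range hΦ.continuous).isBounded
      (isCompact_range hΨ.continuous).isBounded
  refine ⟨fun x z => dist (Φ x) (Ψ (e z)), fun _ _ => dist_nonneg, fun x x' y => ?_,
    fun x y y' => ?_, fun x x' y => ?_, fun x y y' => ?_, fun x => ?_, fun y => ?_⟩
  · rw [← hΦ.dist_eq]
    exact dist_triangle_right _ _ _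
  · rw [← e.isometry.dist_eq, ← hΨ.dist_eq]
    exact dist_triangle_left _ _ _
  · rw [← hΦ.dist_eq]
    exact dist_triangle _ _ _
  · rw [← e.isometry.dist_eq, ← hΨ.dist_eq]
    exact dist_triangle _ _ _
  · obtain ⟨_, ⟨w, rfl⟩, hw⟩ :=
      Metric.exists_dist_lt_of_hausdorffDist_lt (Set.mem_range_self x) h hfin
    exact ⟨e.symm w, by simpa using hw⟩
  · obtain ⟨_, ⟨x, rfl⟩, hx⟩ :=
      Metric.exists_dist_lt_of_hausdorffDist_lt' (Set.mem_range_self (e y)) h hfin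
    exact ⟨x, hx⟩

/-- The cross distance `D`, made invariant by taking the supremum over the group, and made positive
by adding `δ`, extended by the given metrics to the disjoint union. -/
noncomputable def invariantDist {G X Y : Type*} [MetricSpace X] [MetricSpace Y]
    (μ : G → X → X) (ν : G → Y → Y) (D : X → Y → ℝ) (δ : ℝ) : X ⊕ Y → X ⊕ Y → ℝ
  | .inl x, .inl x' => dist x x'
  | .inr y, .inr y' => dist y y'
  | .inl x, .inr y => (⨆ g, D (μ g x) (ν g y)) + δ
  | .inr y, .inl x => (⨆ g, D (μ g x) (ν g y)) + δ

theorem admissible_invariantDist {G X Y : Type*} [Group G] [Finite G] [MetricSpace X]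
    [MetricSpace Y] {μ : G → X → X} {ν : G → Y → Y} (hμ : IsIsoAction μ) (hν : IsIsoAction ν)
    {D : X → Y → ℝ} {ε δ : ℝ} (hD : IsCrossDist D ε) (hδ : 0 < δ) :
    Admissible μ ν (invariantDist μ ν D δ) := by
  have hle : ∀ x y g, D (μ g x) (ν g y) ≤ ⨆ g, D (μ g x) (ν g y) := fun x y g =>
    le_ciSup (f := fun g => D (μ g x) (ν g y)) (Set.finite_range _).bddAbove g
  have hle_one : ∀ x y, D x y ≤ ⨆ g, D (μ g x) (ν g y) := fun x y => by
    simpa [hμ.1, hν.1] using hle x y 1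
  have hl : ∀ x x' y, (⨆ g, D (μ g x) (ν g y)) ≤ dist x x' + ⨆ g, D (μ g x') (ν g y) :=
    fun x x' y => ciSup_le fun g => (hD.le_left _ (μ g x') _).trans
      (by rw [hμ.2.2]; gcongr; exact hle x' y g)
  have hr : ∀ x y y', (⨆ g, D (μ g x) (ν g y)) ≤ (⨆ g, D (μ g x) (ν g y')) + dist y' y :=
    fun x y y' => ciSup_le fun g => (hD.le_right _ _ (ν g y')).trans
      (by rw [hν.2.2]; gcongr; exact hle x y' g)
  have hinv : ∀ g x y, (⨆ h, D (μ h (μ g x)) (ν h (ν g y))) = ⨆ h, D (μ h x) (ν h y) :=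
    fun g x y => by
      simp only [← hμ.2.1, ← hν.2.1]
      exact (Equiv.mulRight g).iSup_comp (g := fun h => D (μ h x) (ν h y))
  refine ⟨?_, ?_, fun _ _ => rfl, fun _ _ => rfl, ?_, fun x y => ?_⟩
  · rintro (x | y) (x' | y') <;> simp [invariantDist, dist_comm]
  · rintro (x | y) (x' | y') (x'' | y'') <;> simp only [invariantDist]
    · exact dist_triangle _ _ _
    · linarith [hl x x' y'']
    · linarith [hD.dist_left_le x x'' y', hle_one x y', hle_one x'' y']
    · linarith [hr x y'' y']
    · linarith [hl x'' x' y, dist_comm x' x'']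
    · linarith [hD.dist_right_le x' y y'', hle_one x' y, hle_one x' y'']
    · linarith [hr x'' y y', dist_comm y y']
    · exact dist_triangle _ _ _
  · rintro g (x | y) (x' | y') <;> simp [invariantDist, hμ.2.2, hν.2.2, hinv]
  · have := (hD.nonneg x y).trans (hle_one x y)
    simp only [invariantDist]
    linarith

theorem hDist_nonneg {X Y : Type*} {d : X ⊕ Y → X ⊕ Y → ℝ}
    (h : ∀ x y, 0 ≤ d (Sum.inl x) (Sum.inr y)) : 0 ≤ hDist d :=
  le_max_of_le_left (Real.iSup_nonneg fun x => Real.iInf_nonneg fun y => h x y)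

theorem hDist_le {X Y : Type*} [Nonempty X] [Nonempty Y] {d : X ⊕ Y → X ⊕ Y → ℝ} {r : ℝ}
    (h : ∀ x y, 0 ≤ d (Sum.inl x) (Sum.inr y))
    (hl : ∀ x, ∃ y, d (Sum.inl x) (Sum.inr y) ≤ r)
    (hr : ∀ y, ∃ x, d (Sum.inl x) (Sum.inr y) ≤ r) : hDist d ≤ r := by
  refine max_le (ciSup_le fun x => ?_) (ciSup_le fun y => ?_)
  · obtain ⟨y, hy⟩ := hl x
    exact ciInf_le_of_le ⟨0, by rintro _ ⟨y, rfl⟩; exact h x y⟩ y hy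
  · obtain ⟨x, hx⟩ := hr y
    exact ciInf_le_of_le ⟨0, by rintro _ ⟨x, rfl⟩; exact h x y⟩ x hx

namespace IsCrossDist

section

variable {X Y : Type*} [MetricSpace X] [MetricSpace Y] {D : X → Y → ℝ} {ε : ℝ}

/-- A point of `Y` close to a given point of `X`. -/
noncomputable def toRight (hD : IsCrossDist D ε) (x : X) : Y := (hD.exists_right x).choose

/-- A point of `X` close to a given point of `Y`. -/
noncomputable def toLeft (hD : IsCrossDist D ε) (y : Y) : X := (hD.exists_left y).choose

theorem toRight_lt (hD : IsCrossDist D ε) (x : X) : D x (hD.toRight x) < ε :=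
  (hD.exists_right x).choose_spec

theorem toLeft_lt (hD : IsCrossDist D ε) (y : Y) : D (hD.toLeft y) y < ε :=
  (hD.exists_left y).choose_spec

theorem dist_toRight_le (hD : IsCrossDist D ε) (x x' : X) :
    dist (hD.toRight x) (hD.toRight x') ≤ dist x x' + 2 * ε := by
  linarith [hD.dist_right_le x (hD.toRight x) (hD.toRight x'), hD.toRight_lt x,
    hD.toRight_lt x', hD.le_left x x' (hD.toRight x')]

theorem le_dist_toRight (hD : IsCrossDist D ε) (x x' : X) :
    dist x x' ≤ dist (hD.toRight x) (hD.toRight x') + 2 * ε := by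
  linarith [hD.dist_left_le x x' (hD.toRight x), hD.toRight_lt x, hD.toRight_lt x',
    hD.le_right x' (hD.toRight x) (hD.toRight x'),
    dist_comm (hD.toRight x) (hD.toRight x')]

theorem dist_toLeft_le (hD : IsCrossDist D ε) (y y' : Y) :
    dist (hD.toLeft y) (hD.toLeft y') ≤ dist y y' + 2 * ε := by
  linarith [hD.dist_left_le (hD.toLeft y) (hD.toLeft y') y', hD.toLeft_lt y,
    hD.toLeft_lt y', hD.le_right (hD.toLeft y) y' y]

theorem le_dist_toLeft (hD : IsCrossDist D ε) (y y' : Y) :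
    dist y y' ≤ dist (hD.toLeft y) (hD.toLeft y') + 2 * ε := by
  linarith [hD.dist_right_le (hD.toLeft y) y y', hD.toLeft_lt y, hD.toLeft_lt y',
    hD.le_left (hD.toLeft y) (hD.toLeft y') y']

theorem dist_toRight_toLeft_le (hD : IsCrossDist D ε) (y : Y) :
    dist (hD.toRight (hD.toLeft y)) y ≤ 2 * ε := by
  linarith [hD.dist_right_le (hD.toLeft y) (hD.toRight (hD.toLeft y)) y,
    hD.toRight_lt (hD.toLeft y), hD.toLeft_lt y]

theorem dist_toLeft_toRight_le (hD : IsCrossDist D ε) (x : X) :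
    dist x (hD.toLeft (hD.toRight x)) ≤ 2 * ε := by
  linarith [hD.dist_left_le x (hD.toLeft (hD.toRight x)) (hD.toRight x),
    hD.toRight_lt x, hD.toLeft_lt (hD.toRight x)]

/-- The map on `Y` that approximates a given map on `X`. -/
noncomputable def transfer (hD : IsCrossDist D ε) (f : X → X) (y : Y) : Y :=
  hD.toRight (f (hD.toLeft y))

theorem dist_transfer_le (hD : IsCrossDist D ε) {f : X → X}
    (hf : ∀ x x', dist (f x) (f x') = dist x x') (y y' : Y) :
    dist (hD.transfer f y) (hD.transfer f y') ≤ dist y y' + 4 * ε := by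
  have := hD.dist_toRight_le (f (hD.toLeft y)) (f (hD.toLeft y'))
  rw [hf] at this
  unfold transfer
  linarith [hD.dist_toLeft_le y y']

theorem le_dist_transfer (hD : IsCrossDist D ε) {f : X → X}
    (hf : ∀ x x', dist (f x) (f x') = dist x x') (y y' : Y) :
    dist y y' ≤ dist (hD.transfer f y) (hD.transfer f y') + 4 * ε := by
  have := hD.le_dist_toRight (f (hD.toLeft y)) (f (hD.toLeft y'))
  rw [hf] at this
  unfold transfer
  linarith [hD.le_dist_toLeft y y']

theorem dist_transfer_comp_le (hD : IsCrossDist D ε) {f f' : X → X}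
    (hf : ∀ x x', dist (f x) (f x') = dist x x') (y : Y) :
    dist (hD.transfer (f ∘ f') y) (hD.transfer f (hD.transfer f' y)) ≤ 4 * ε := by
  have := hD.dist_toRight_le (f (f' (hD.toLeft y)))
    (f (hD.toLeft (hD.toRight (f' (hD.toLeft y)))))
  rw [hf] at this
  simp only [transfer, Function.comp_apply]
  linarith [hD.dist_toLeft_toRight_le (f' (hD.toLeft y))]

theorem hDist_invariantDist_le {G : Type*} [Nonempty G] [Nonempty X] [Nonempty Y]
    {μ : G → X → X} {ν : G → Y → Y} (hD : IsCrossDist D ε) {δ η : ℝ} (hδ : 0 ≤ δ)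
    (hμ : ∀ g x x', dist (μ g x) (μ g x') = dist x x')
    (h : ∀ g y, dist (hD.transfer (μ g) y) (ν g y) ≤ η) :
    hDist (invariantDist μ ν D δ) ≤ 5 * ε + η + δ := by
  refine hDist_le (fun x y => ?_) (fun x => ⟨hD.toRight x, ?_⟩) (fun y => ⟨hD.toLeft y, ?_⟩)
  · exact add_nonneg (Real.iSup_nonneg fun g => hD.nonneg _ _) hδ
  · refine add_le_add (ciSup_le fun g => ?_) le_rfl
    have := hD.dist_toRight_le (μ g x) (μ g (hD.toLeft (hD.toRight x)))
    rw [hμ] at this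
    linarith [hD.le_right (μ g x) (ν g (hD.toRight x)) (hD.toRight (μ g x)),
      hD.toRight_lt (μ g x), hD.dist_toLeft_toRight_le x,
      dist_triangle (hD.toRight (μ g x)) (hD.transfer (μ g) (hD.toRight x))
        (ν g (hD.toRight x)), h g (hD.toRight x),
      show dist (hD.toRight (μ g x)) (hD.transfer (μ g) (hD.toRight x)) =
        dist (hD.toRight (μ g x)) (hD.toRight (μ g (hD.toLeft (hD.toRight x)))) from rfl]
  · refine add_le_add (ciSup_le fun g => ?_) le_rfl
    have h₁ := hD.le_right (μ g (hD.toLeft y)) (ν g y) (hD.transfer (μ g) y)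
    have h₂ : D (μ g (hD.toLeft y)) (hD.transfer (μ g) y) < ε := hD.toRight_lt _
    linarith [h g y, hD.nonneg (μ g (hD.toLeft y)) (hD.transfer (μ g) y)]

end

section Limit

variable {G : Type*} [Group G] {X : ℕ → Type*} [∀ i, MetricSpace (X i)]
  {μ : ∀ i, G → X i → X i} {Z : Type*} [MetricSpace Z]
  {D : ∀ i, X i → Z → ℝ} {ε : ℕ → ℝ} {U : Filter ℕ} [U.NeBot] {ν : G → Z → Z}

/-- The pointwise limit of the approximate actions transferred from the `X i` is an isometric
action. -/
theorem isIsoAction_of_tendsto (hμ : ∀ i, IsIsoAction (μ i)) (hD : ∀ i, IsCrossDist (D i) (ε i))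
    (hε : Tendsto ε U (nhds 0))
    (hν : ∀ g z, Tendsto (fun i => (hD i).transfer (μ i g) z) U (nhds (ν g z))) :
    IsIsoAction ν := by
  have hiso : ∀ g z z', dist (ν g z) (ν g z') = dist z z' := fun g z z' => by
    have hd := (hν g z).dist (hν g z')
    have h4 := hε.const_mul 4
    rw [mul_zero] at h4
    refine le_antisymm ?_ ?_
    · simpa using le_of_tendsto_of_tendsto' hd (tendsto_const_nhds.add h4)
        fun i => (hD i).dist_transfer_le ((hμ i).2.2 g) z z'
    · simpa using le_of_tendsto_of_tendsto' tendsto_const_nhds (hd.add h4)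
        fun i => (hD i).le_dist_transfer ((hμ i).2.2 g) z z'
  refine ⟨fun z => ?_, fun g g' z => ?_, hiso⟩
  · refine dist_le_zero.1 (le_of_tendsto_of_tendsto' ((hν 1 z).dist tendsto_const_nhds)
      (by simpa using hε.const_mul 2) fun i => ?_)
    simpa [transfer, (hμ i).1] using (hD i).dist_toRight_toLeft_le z
  · have hlim : Tendsto (fun i => 4 * ε i + (dist ((hD i).transfer (μ i g') z) (ν g' z) + 4 * ε i))
        U (nhds 0) := by
      simpa using (hε.const_mul 4).add
        (((hν g' z).dist (tendsto_const_nhds (x := ν g' z))).add (hε.const_mul 4))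
    refine dist_le_zero.1 (le_of_tendsto_of_tendsto' ((hν (g * g') z).dist (hν g (ν g' z)))
      hlim fun i => ?_)
    have hcomp : μ i (g * g') = μ i g ∘ μ i g' := funext fun x => (hμ i).2.1 g g' x
    rw [hcomp]
    exact (dist_triangle _ _ _).trans (add_le_add
      ((hD i).dist_transfer_comp_le ((hμ i).2.2 g) z)
      ((hD i).dist_transfer_le ((hμ i).2.2 g) _ _))

/-- On a compact space, pointwise convergence of the transferred actions is uniform. -/
theorem eventually_forall_dist_transfer_le [Finite G] [CompactSpace Z]
    (hμ : ∀ i, IsIsoAction (μ i)) (hD : ∀ i, IsCrossDist (D i) (ε i))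
    (hε : Tendsto ε U (nhds 0))
    (hν : ∀ g z, Tendsto (fun i => (hD i).transfer (μ i g) z) U (nhds (ν g z)))
    {η : ℝ} (hη : 0 < η) :
    ∀ᶠ i in U, ∀ g z, dist ((hD i).transfer (μ i g) z) (ν g z) ≤ η := by
  obtain ⟨t, -, ht, hcover⟩ := Metric.finite_approx_of_totallyBounded
    (isCompact_univ (X := Z)).totallyBounded (η / 8) (by positivity)
  have hiso := (isIsoAction_of_tendsto hμ hD hε hν).2.2
  have hpt : ∀ᶠ i in U, ∀ g, ∀ w ∈ t, dist ((hD i).transfer (μ i g) w) (ν g w) < η / 4 :=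
    eventually_all.2 fun g => (eventually_all_finite ht).2 fun w _ =>
      Metric.tendsto_nhds.1 (hν g w) _ (by positivity)
  filter_upwards [hpt, hε.eventually_lt_const (show 0 < η / 16 by positivity)] with i hi hεi g z
  obtain ⟨w, hw, hzw⟩ := Set.mem_iUnion₂.1 (hcover (Set.mem_univ z))
  have hzw' : dist z w < η / 8 := hzw
  have hνw := hiso g w z
  rw [dist_comm w z] at hνw
  linarith [dist_triangle4 ((hD i).transfer (μ i g) z) ((hD i).transfer (μ i g) w) (ν g w)
    (ν g z), hi g w hw, (hD i).dist_transfer_le ((hμ i).2.2 g) z w]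

end Limit

end IsCrossDist

/-- properness of the forgetful map. If a sequence of nonempty compact
metric `G`-spaces `Xᵢ` converges in the ordinary Gromov--Hausdorff distance to some
nonempty compact metric space `W`, then there are a nonempty compact metric space `Z`
with a `G`-action by isometries, a subsequence `X_{φ(i)}`, and admissible `G`-invariant
metrics `dᵢ` on `X_{φ(i)} ⊔ Z` whose Hausdorff distances tend to `0`. -/
theorem stmt6 (G : Type*) [Group G] [Fintype G]
    (X : ℕ → Type u) [∀ i, MetricSpace (X i)]
    [∀ i, CompactSpace (X i)] [∀ i, Nonempty (X i)]
    (μ : ∀ i, G → X i → X i) (hμ : ∀ i, IsIsoAction (μ i))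
    (W : Type v) [MetricSpace W] [CompactSpace W] [Nonempty W]
    (hconv : Tendsto (fun i => GromovHausdorff.ghDist (X i) W) atTop (nhds 0)) :
    ∃ (Z : Type u) (mZ : MetricSpace Z),
      letI := mZ
      Nonempty Z ∧ CompactSpace Z ∧
      ∃ ν : G → Z → Z, IsIsoAction ν ∧
      ∃ φ : ℕ → ℕ, StrictMono φ ∧
      ∃ d : (i : ℕ) → (X (φ i) ⊕ Z) → (X (φ i) ⊕ Z) → ℝ,
        (∀ i, Admissible (μ (φ i)) ν (d i)) ∧
        Tendsto (fun i => hDist (d i)) atTop (nhds 0) := by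
  let Z := ULift.{u} (GromovHausdorff.toGHSpace W).Rep
  obtain ⟨e₀⟩ := GromovHausdorff.toGHSpace_eq_toGHSpace_iff_isometryEquiv.1
    (GromovHausdorff.GHSpace.toGHSpace_rep (GromovHausdorff.toGHSpace W))
  let e : Z ≃ᵢ W := (IsometryEquiv.mk Equiv.ulift fun _ _ => rfl).trans e₀
  let ε : ℕ → ℝ := fun i => GromovHausdorff.ghDist (X i) W + 1 / ((i : ℝ) + 1)
  have hε : Tendsto ε atTop (nhds 0) := by
    have h := hconv.add (tendsto_one_div_add_atTop_nhds_zero_nat (𝕜 := ℝ))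
    rwa [add_zero] at h
  choose D hD using fun i => exists_isCrossDist (X i) W Z e
    (lt_add_of_pos_right _ (Nat.one_div_pos_of_nat (α := ℝ) (n := i)) :
      GromovHausdorff.ghDist (X i) W < ε i)
  have hU : (hyperfilter ℕ : Filter ℕ) ≤ atTop := Nat.hyperfilter_le_atTop
  have hlim : ∀ g z, ∃ w, Tendsto (fun i => (hD i).transfer (μ i g) z) (hyperfilter ℕ) (nhds w) :=
    fun g z => by
      obtain ⟨w, -, hw⟩ := isCompact_univ.ultrafilter_le_nhds
        ((hyperfilter ℕ).map fun i => (hD i).transfer (μ i g) z) (by simp)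
      exact ⟨w, hw⟩
  choose ν hν using hlim
  have hact : IsIsoAction ν := IsCrossDist.isIsoAction_of_tendsto hμ hD (hε.mono_left hU) hν
  have hfreq : ∀ n : ℕ, ∃ᶠ i in atTop, ε i < 1 / ((n : ℝ) + 1) ∧
      ∀ g z, dist ((hD i).transfer (μ i g) z) (ν g z) ≤ 1 / ((n : ℝ) + 1) := fun n => by
    have hn : (0 : ℝ) < 1 / ((n : ℝ) + 1) := Nat.one_div_pos_of_nat
    exact (((hε.mono_left hU).eventually_lt_const hn).and
      (IsCrossDist.eventually_forall_dist_transfer_le hμ hD (hε.mono_left hU) hν hn)).frequently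
        |>.filter_mono hU
  obtain ⟨φ, hφ, hφν⟩ := extraction_forall_of_frequently hfreq
  refine ⟨Z, inferInstance, inferInstance, inferInstance, ν, hact, φ, hφ,
    fun n => invariantDist (μ (φ n)) ν (D (φ n)) (1 / ((n : ℝ) + 1)),
    fun n => admissible_invariantDist (hμ _) hact (hD _) Nat.one_div_pos_of_nat, ?_⟩
  have hbound : Tendsto (fun n : ℕ => 7 * (1 / ((n : ℝ) + 1))) atTop (nhds 0) := by
    simpa using tendsto_one_div_add_atTop_nhds_zero_nat.const_mul (7 : ℝ)
  refine squeeze_zero (fun n => hDist_nonneg fun x z => ?_) (fun n => ?_) hbound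
  · exact ((admissible_invariantDist (hμ _) hact (hD _) Nat.one_div_pos_of_nat).2.2.2.2.2 x z).le
  · refine ((hD (φ n)).hDist_invariantDist_le Nat.one_div_pos_of_nat.le (hμ _).2.2
      (hφν n).2).trans ?_
    linarith [(hφν n).1]
end

section
/- Let G be a finite group and for each i ∈ ℕ let Xᵢ be a nonempty compact metric space equipped with an action of G by isometries. Assume that (Xᵢ) converges in the Gromov–Hausdorff distance to a nonempty compact metric space X (the convergence being of the underlying metric spaces, disregarding the actions). Then there exist an action of G on X by isometries, a strictly increasing function φ : ℕ → ℕ, and for each i an admissible G-invariant metric dᵢ on X_{φ(i)} ⊔ X, such that the Hausdorff distance between X_{φ(i)} and X with respect to dᵢ tends to 0 as i → ∞; that is, a subsequence of (Xᵢ) converges to X in the G-equivariant sense. -/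
open Metric Filter

/-- Gromov-Hausdorff close compact spaces are related by a map of small distortion
which has an approximate right inverse. -/
lemma exists_approx_isometry_of_ghDist_lt (X : Type*) (Y : Type*)
    [MetricSpace X] [CompactSpace X] [Nonempty X]
    [MetricSpace Y] [CompactSpace Y] [Nonempty Y] {r : ℝ}
    (hr : GromovHausdorff.ghDist X Y < r) :
    ∃ (f : X → Y) (h : Y → X), (∀ x x', |dist (f x) (f x') - dist x x'| ≤ 2 * r) ∧
      ∀ y, dist (f (h y)) y ≤ 2 * r := by
  set a := GromovHausdorff.optimalGHInjl X Y
  set b := GromovHausdorff.optimalGHInjr X Y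
  have ha : Isometry a := GromovHausdorff.isometry_optimalGHInjl X Y
  have hb : Isometry b := GromovHausdorff.isometry_optimalGHInjr X Y
  rw [← GromovHausdorff.hausdorffDist_optimal] at hr
  have fin : hausdorffEDist (Set.range a) (Set.range b) ≠ ⊤ :=
    hausdorffEDist_ne_top_of_nonempty_of_bounded (Set.range_nonempty _) (Set.range_nonempty _)
      (isCompact_range ha.continuous).isBounded (isCompact_range hb.continuous).isBounded
  have hf : ∀ x, ∃ y, dist (a x) (b y) < r := fun x => by
    obtain ⟨_, ⟨y, rfl⟩, hy⟩ := exists_dist_lt_of_hausdorffDist_lt (Set.mem_range_self x) hr fin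
    exact ⟨y, hy⟩
  have hh : ∀ y, ∃ x, dist (a x) (b y) < r := fun y => by
    obtain ⟨_, ⟨x, rfl⟩, hx⟩ := exists_dist_lt_of_hausdorffDist_lt' (Set.mem_range_self y) hr fin
    exact ⟨x, hx⟩
  choose f hf using hf
  choose h hh using hh
  refine ⟨f, h, fun x x' => ?_, fun y => ?_⟩
  · rw [← ha.dist_eq, ← hb.dist_eq, ← Real.dist_eq]
    refine (dist_dist_dist_le _ _ _ _).trans ?_
    rw [dist_comm (b _), dist_comm (b _)]
    linarith [hf x, hf x']
  · rw [← hb.dist_eq]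
    linarith [dist_triangle_left (b (f (h y))) (b y) (a (h y)), hf (h y), hh y]

lemma hDist_nonneg_s7 {G X Y : Type*} [MetricSpace X] [MetricSpace Y]
    {μ : G → X → X} {ν : G → Y → Y} {d : X ⊕ Y → X ⊕ Y → ℝ} (hd : Admissible μ ν d) :
    0 ≤ hDist d :=
  le_max_of_le_left <| Real.iSup_nonneg fun x => Real.iInf_nonneg fun y =>
    (hd.2.2.2.2.2 x y).le

/-- An almost equivariant, almost surjective map of small distortion between `G`-spaces yields
an admissible invariant metric for which the two spaces are Hausdorff close. -/
lemma exists_admissible_hDist_le {G X Y : Type*} [Group G] [MetricSpace X] [Nonempty X]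
    [MetricSpace Y] [Nonempty Y] {μ : G → X → X} {ν : G → Y → Y}
    (hμ : IsIsoAction μ) (hν : IsIsoAction ν) (f : X → Y) (h : Y → X) {δ : ℝ} (hδ : 0 < δ)
    (hf : ∀ x x', |dist (f x) (f x') - dist x x'| ≤ δ) (hfh : ∀ y, dist (f (h y)) y ≤ δ)
    (hequiv : ∀ g x, dist (f (μ g x)) (ν g (f x)) ≤ δ) :
    ∃ d : X ⊕ Y → X ⊕ Y → ℝ, Admissible μ ν d ∧ hDist d ≤ 3 * δ := by
  let Φ : G × X → X := fun p => μ p.1 p.2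
  let Ψ : G × X → Y := fun p => ν p.1 (f p.2)
  have H : ∀ p q, |dist (Φ p) (Φ q) - dist (Ψ p) (Ψ q)| ≤ 2 * (3 / 2 * δ) := by
    intro p q
    have h1 := hf (Φ p) (Φ q)
    have h2 := dist_dist_dist_le (f (Φ p)) (f (Φ q)) (Ψ p) (Ψ q)
    have h3 : dist (f (Φ p)) (Ψ p) ≤ δ := hequiv p.1 p.2
    have h4 : dist (f (Φ q)) (Ψ q) ≤ δ := hequiv q.1 q.2
    rw [Real.dist_eq] at h2
    rw [abs_le] at *
    constructor <;> linarith
  have hε : 0 < 3 / 2 * δ := by positivity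
  let m : MetricSpace (X ⊕ Y) := glueMetricApprox Φ Ψ (3 / 2 * δ) hε H
  have hpos : ∀ (x : X) (y : Y), 0 < m.dist (Sum.inl x) (Sum.inr y) := fun x y =>
    add_pos_of_nonneg_of_pos (Real.iInf_nonneg fun p => by positivity) hε
  have hglue : ∀ x, m.dist (Sum.inl x) (Sum.inr (f x)) = 3 / 2 * δ := fun x => by
    have := glueDist_glued_points Φ Ψ (3 / 2 * δ) (1, x)
    simp only [Φ, Ψ, hμ.1, hν.1] at this
    exact this
  have hinv : ∀ (g : G) (x : X) (y : Y), (⨅ p, dist (μ g x) (Φ p) + dist (ν g y) (Ψ p)) =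
      ⨅ p, dist x (Φ p) + dist y (Ψ p) := fun g x y => by
    refine (Equiv.iInf_congr ((Equiv.mulLeft g).prodCongr (Equiv.refl X)) fun p => ?_).symm
    simp [Φ, Ψ, hμ.2.1, hν.2.1, hμ.2.2, hν.2.2]
  refine ⟨m.dist, ⟨dist_comm, dist_triangle, fun _ _ => rfl, fun _ _ => rfl, ?_, hpos⟩, ?_⟩
  · rintro g (x | x) (y | y)
    · exact hμ.2.2 g x y
    · exact congrArg (· + 3 / 2 * δ) (hinv g x y)
    · exact congrArg (· + 3 / 2 * δ) (hinv g y x)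
    · exact hν.2.2 g x y
  · refine max_le (ciSup_le fun x => ?_) (ciSup_le fun y => ?_)
    · refine (ciInf_le ⟨0, ?_⟩ (f x)).trans (by rw [hglue]; linarith)
      rintro _ ⟨y, rfl⟩
      exact (hpos x y).le
    · refine (ciInf_le ⟨0, ?_⟩ (h y)).trans ?_
      · rintro _ ⟨x, rfl⟩
        exact (hpos x y).le
      · have h1 : m.dist (Sum.inl (h y)) (Sum.inr y) ≤
            m.dist (Sum.inl (h y)) (Sum.inr (f (h y))) +
              m.dist (Sum.inr (f (h y))) (Sum.inr y) := dist_triangle _ _ _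
        have h2 : m.dist (Sum.inr (f (h y))) (Sum.inr y) ≤ δ := hfh y
        rw [hglue] at h1
        linarith

/-- Isometric actions of a finite group transported along almost isometries `X i → Y` converge,
along an ultrafilter, to an isometric action on the compact space `Y`, for which the almost
isometries are almost equivariant. -/
lemma exists_isIsoAction_of_approx_isometry {ι G Y : Type*} [Group G] [Finite G]
    (U : Ultrafilter ι) {X : ι → Type*} [∀ i, MetricSpace (X i)] [MetricSpace Y] [CompactSpace Y]
    {μ : ∀ i, G → X i → X i} (hμ : ∀ i, IsIsoAction (μ i))
    (f : ∀ i, X i → Y) (h : ∀ i, Y → X i) {ε : ι → ℝ} (hε : Tendsto ε U (nhds 0))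
    (hf : ∀ i x x', |dist (f i x) (f i x') - dist x x'| ≤ ε i)
    (hfh : ∀ i y, dist (f i (h i y)) y ≤ ε i) :
    ∃ ν : G → Y → Y, IsIsoAction ν ∧
      ∀ δ > 0, ∀ᶠ i in (U : Filter ι), ∀ g x, dist (f i (μ i g x)) (ν g (f i x)) ≤ δ := by
  let N : G → Y → ι → Y := fun g y i => f i (μ i g (h i y))
  have hN : ∀ g y, ∃ z, Tendsto (N g y) U (nhds z) := fun g y => by
    obtain ⟨z, -, hz⟩ := isCompact_univ.ultrafilter_le_nhds (U.map (N g y)) (by simp)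
    exact ⟨z, hz⟩
  choose ν hν using hN
  have hle : ∀ i x x', dist (f i x) (f i x') ≤ dist x x' + ε i := fun i x x' => by
    linarith [(abs_le.1 (hf i x x')).2]
  have hge : ∀ i x x', dist x x' ≤ dist (f i x) (f i x') + ε i := fun i x x' => by
    linarith [(abs_le.1 (hf i x x')).1]
  have hiso : ∀ g y y', dist (ν g y) (ν g y') = dist y y' := by
    intro g y y'
    refine tendsto_nhds_unique ((hν g y).dist (hν g y')) ?_
    rw [tendsto_iff_dist_tendsto_zero]
    refine squeeze_zero (fun _ => dist_nonneg) (fun i => ?_)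
      (by simpa using hε.const_mul 4 : Tendsto (fun i => 4 * ε i) U (nhds 0))
    have h1 := hf i (μ i g (h i y)) (μ i g (h i y'))
    rw [(hμ i).2.2] at h1
    have h2 := hf i (h i y) (h i y')
    have h3 := dist_dist_dist_le (f i (h i y)) (f i (h i y')) y y'
    have h4 := hfh i y
    have h5 := hfh i y'
    rw [Real.dist_eq] at h3 ⊢
    rw [abs_le] at *
    simp only [N]
    constructor <;> linarith
  refine ⟨ν, ⟨fun y => ?_, fun g g' y => ?_, hiso⟩, fun δ hδ => ?_⟩
  · refine tendsto_nhds_unique (hν 1 y) ?_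
    rw [tendsto_iff_dist_tendsto_zero]
    refine squeeze_zero (fun _ => dist_nonneg) (fun i => ?_) hε
    simpa only [N, (hμ i).1] using hfh i y
  · refine tendsto_nhds_unique (hν (g * g') y) ?_
    refine (tendsto_iff_of_dist ?_).1 (hν g (ν g' y))
    have h1 := tendsto_iff_dist_tendsto_zero.1 (hν g' y)
    have h2 : Tendsto (fun i => 3 * ε i + dist (N g' y i) (ν g' y)) U (nhds 0) := by
      simpa using (hε.const_mul 3).add h1
    refine squeeze_zero (fun _ => dist_nonneg) (fun i => ?_) h2
    simp only [N, (hμ i).2.1]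
    have h3 := hle i (μ i g (h i (ν g' y))) (μ i g (μ i g' (h i y)))
    rw [(hμ i).2.2] at h3
    have h4 := hge i (h i (ν g' y)) (μ i g' (h i y))
    have h5 := dist_triangle_right (f i (h i (ν g' y))) (f i (μ i g' (h i y))) (ν g' y)
    linarith [hfh i (ν g' y)]
  · obtain ⟨t, -, ht, hcover⟩ := finite_cover_balls_of_compact (isCompact_univ (X := Y))
      (show 0 < δ / 6 by positivity)
    have h1 : ∀ᶠ i in (U : Filter ι), ∀ g, ∀ z ∈ t, dist (N g z i) (ν g z) < δ / 6 :=
      eventually_all.2 fun g => ht.eventually_all.2 fun z _ =>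
        Metric.tendsto_nhds.1 (hν g z) _ (by positivity)
    filter_upwards [h1, hε.eventually_lt_const (show 0 < δ / 6 by positivity)] with i hi hεi g x
    obtain ⟨z, hz, hxz⟩ : ∃ z ∈ t, dist (f i x) z < δ / 6 := by
      simpa using hcover (Set.mem_univ (f i x))
    have h2 := hle i (μ i g x) (μ i g (h i z))
    rw [(hμ i).2.2] at h2
    have h3 := hge i x (h i z)
    have h4 := dist_triangle_right (f i x) (f i (h i z)) z
    have h5 := hfh i z
    have h6 : dist (f i (μ i g (h i z))) (ν g z) < δ / 6 := hi g z hz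
    have h7 := dist_triangle4 (f i (μ i g x)) (f i (μ i g (h i z))) (ν g z) (ν g (f i x))
    rw [hiso, dist_comm z] at h7
    linarith

/-- If a sequence of nonempty compact metric `G`-spaces `Xᵢ` converges
in the ordinary Gromov--Hausdorff distance (disregarding the actions) to a nonempty
compact metric space `Y`, then `G` acts on `Y` by isometries in such a way that a
subsequence of `(Xᵢ)` converges to `Y` in the `G`-equivariant sense: there are admissible
`G`-invariant metrics `dᵢ` on `X_{φ(i)} ⊔ Y` with Hausdorff distance tending to `0`. -/
theorem stmt7 (G : Type*) [Group G] [Fintype G]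
    (X : ℕ → Type u) [∀ i, MetricSpace (X i)]
    [∀ i, CompactSpace (X i)] [∀ i, Nonempty (X i)]
    (μ : ∀ i, G → X i → X i) (hμ : ∀ i, IsIsoAction (μ i))
    (Y : Type v) [MetricSpace Y] [CompactSpace Y] [Nonempty Y]
    (hconv : Tendsto (fun i => GromovHausdorff.ghDist (X i) Y) atTop (nhds 0)) :
    ∃ ν : G → Y → Y, IsIsoAction ν ∧
      ∃ φ : ℕ → ℕ, StrictMono φ ∧
      ∃ d : (i : ℕ) → (X (φ i) ⊕ Y) → (X (φ i) ⊕ Y) → ℝ,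
        (∀ i, Admissible (μ (φ i)) ν (d i)) ∧
        Tendsto (fun i => hDist (d i)) atTop (nhds 0) := by
  have hr0 : Tendsto (fun i => GromovHausdorff.ghDist (X i) Y + 1 / ((i : ℝ) + 1))
      atTop (nhds 0) := by
    simpa using hconv.add (tendsto_one_div_add_atTop_nhds_zero_nat (𝕜 := ℝ))
  have hε := hr0.const_mul 2
  rw [mul_zero] at hε
  have hr : ∀ i, GromovHausdorff.ghDist (X i) Y <
      GromovHausdorff.ghDist (X i) Y + 1 / ((i : ℝ) + 1) := fun i =>
    lt_add_of_pos_right _ (by positivity)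
  choose f h hf hfh using fun i => exists_approx_isometry_of_ghDist_lt (X i) Y (hr i)
  have hU : ((hyperfilter ℕ : Ultrafilter ℕ) : Filter ℕ) ≤ atTop := Nat.hyperfilter_le_atTop
  obtain ⟨ν, hν, hequiv⟩ := exists_isIsoAction_of_approx_isometry (hyperfilter ℕ) hμ f h
    (hε.mono_left hU) hf hfh
  refine ⟨ν, hν, ?_⟩
  have hfreq : ∀ k : ℕ, ∃ᶠ i in atTop, ∃ d : X i ⊕ Y → X i ⊕ Y → ℝ,
      Admissible (μ i) ν d ∧ hDist d ≤ 3 * (1 / ((k : ℝ) + 1)) := fun k => by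
    have hk : 0 < 1 / ((k : ℝ) + 1) := by positivity
    refine Frequently.filter_mono (Eventually.frequently ?_) hU
    filter_upwards [hequiv _ hk, (hε.mono_left hU).eventually_lt_const hk] with i hi hεi
    exact exists_admissible_hDist_le (hμ i) hν (f i) (h i) hk
      (fun x x' => (hf i x x').trans hεi.le) (fun y => (hfh i y).trans hεi.le) hi
  obtain ⟨φ, hφ, hd⟩ := extraction_forall_of_frequently hfreq
  choose d hd hdle using hd
  refine ⟨φ, hφ, d, hd, squeeze_zero (fun k => hDist_nonneg_s7 (hd k)) hdle ?_⟩
  simpa using (tendsto_one_div_add_atTop_nhds_zero_nat (𝕜 := ℝ)).const_mul 3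
end

section
/- Let G be a finite group and for each i ∈ ℕ let Xᵢ be a nonempty compact metric space equipped with an action of G by isometries, and assume (Xᵢ) converges in the Gromov–Hausdorff distance to a nonempty compact metric space X. Then there exist an action of G on X by isometries, a strictly increasing φ : ℕ → ℕ, and admissible G-invariant metrics dᵢ on X_{φ(i)} ⊔ X with Hausdorff distance between X_{φ(i)} and X tending to 0, and moreover, setting Dᵢ(a,b) := min_{g∈G} dᵢ(a, g·b), both sup_{x ∈ X_{φ(i)}} inf_{y ∈ X} Dᵢ(x,y) → 0 and sup_{y ∈ X} inf_{x ∈ X_{φ(i)}} Dᵢ(x,y) → 0 as i → ∞ (i.e. the quotients G\X_{φ(i)} converge to G\X in the Gromov–Hausdorff sense). -/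
open Metric Filter

/-- A function `c : X → Y → ℝ` which, together with the metrics of `X` and `Y`, satisfies all
triangle inequalities, i.e. defines a pseudometric on `X ⊕ Y` extending the given metrics. -/
structure IsCoupling {X Y : Type*} [MetricSpace X] [MetricSpace Y] (c : X → Y → ℝ) : Prop where
  le_left : ∀ x x' y, c x y ≤ dist x x' + c x' y
  le_right : ∀ x y y', c x y ≤ c x y' + dist y' y
  dist_left : ∀ x x' y, dist x x' ≤ c x y + c x' y
  dist_right : ∀ x y y', dist y y' ≤ c x y + c x y'

namespace IsCoupling

section Basic

variable {X Y : Type*} [MetricSpace X] [MetricSpace Y] {c : X → Y → ℝ}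

theorem nonneg (hc : IsCoupling c) (x : X) (y : Y) : 0 ≤ c x y := by
  have := hc.dist_left x x y
  rw [dist_self] at this
  linarith

/-- The extension of the metrics of `X` and `Y` to `X ⊕ Y` given by a coupling. -/
def sumDist (c : X → Y → ℝ) : X ⊕ Y → X ⊕ Y → ℝ
  | .inl x, .inl x' => dist x x'
  | .inl x, .inr y => c x y
  | .inr y, .inl x => c x y
  | .inr y, .inr y' => dist y y'

theorem admissible_sumDist {G : Type*} [Monoid G] {μ : G → X → X} {ν : G → Y → Y}
    (hc : IsCoupling c) (hμ : IsIsoAction μ) (hν : IsIsoAction ν)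
    (hinv : ∀ g x y, c (μ g x) (ν g y) = c x y) (hpos : ∀ x y, 0 < c x y) :
    Admissible μ ν (sumDist c) := by
  refine ⟨?_, ?_, fun _ _ => rfl, fun _ _ => rfl, ?_, hpos⟩
  · rintro (x | y) (x' | y') <;> simp [sumDist, dist_comm]
  · rintro (x | y) (x' | y') (x'' | y'') <;> simp only [sumDist]
    · exact dist_triangle _ _ _
    · exact hc.le_left _ _ _
    · exact hc.dist_left _ _ _
    · exact hc.le_right _ _ _
    · have := hc.le_left x'' x' y
      rw [dist_comm] at this
      linarith
    · exact hc.dist_right _ _ _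
    · have := hc.le_right x'' y y'
      rw [dist_comm] at this
      linarith
    · exact dist_triangle _ _ _
  · rintro g (x | y) (x' | y') <;> simp [sumDist, hinv, hμ.2.2, hν.2.2]

/-- The maximum of the translates of a coupling, shifted by a constant. -/
theorem iSup_translate {G : Type*} [Group G] [Finite G] {μ : G → X → X} {ν : G → Y → Y}
    (hc : IsCoupling c) (hμ : IsIsoAction μ) (hν : IsIsoAction ν) {δ : ℝ} (hδ : 0 ≤ δ) :
    IsCoupling fun x y => δ + ⨆ g, c (μ g x) (ν g y) := by
  have hle : ∀ x y g, c (μ g x) (ν g y) ≤ ⨆ g, c (μ g x) (ν g y) := fun x y g =>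
    le_ciSup (f := fun g => c (μ g x) (ν g y)) (Set.finite_range _).bddAbove g
  have hle_one : ∀ x y, c x y ≤ ⨆ g, c (μ g x) (ν g y) := fun x y => by
    simpa only [hμ.1, hν.1] using hle x y 1
  refine ⟨fun x x' y => ?_, fun x y y' => ?_, fun x x' y => ?_, fun x y y' => ?_⟩
  · have : ⨆ g, c (μ g x) (ν g y) ≤ dist x x' + ⨆ g, c (μ g x') (ν g y) := ciSup_le fun g => by
      have h := hc.le_left (μ g x) (μ g x') (ν g y)
      rw [hμ.2.2] at h
      linarith [hle x' y g]
    linarith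
  · have : ⨆ g, c (μ g x) (ν g y) ≤ (⨆ g, c (μ g x) (ν g y')) + dist y' y := ciSup_le fun g => by
      have h := hc.le_right (μ g x) (ν g y) (ν g y')
      rw [hν.2.2] at h
      linarith [hle x y' g]
    linarith
  · linarith [hc.dist_left x x' y, hle_one x y, hle_one x' y]
  · linarith [hc.dist_right x y y', hle_one x y, hle_one x y']

theorem iSup_translate_map {G : Type*} [Group G] {μ : G → X → X} {ν : G → Y → Y}
    (hμ : IsIsoAction μ) (hν : IsIsoAction ν) (k : G) (x : X) (y : Y) :
    ⨆ g, c (μ g (μ k x)) (ν g (ν k y)) = ⨆ g, c (μ g x) (ν g y) := by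
  simp only [← hμ.2.1, ← hν.2.1]
  exact (Equiv.mulRight k).iSup_comp (g := fun g => c (μ g x) (ν g y))

/-- An approximately equivariant coupling with small Hausdorff distance can be replaced by an
admissible invariant metric with small Hausdorff distance. -/
theorem exists_admissible {G : Type*} [Group G] [Finite G] {μ : G → X → X} {ν : G → Y → Y}
    (hc : IsCoupling c) (hμ : IsIsoAction μ) (hν : IsIsoAction ν) {δ : ℝ} (hδ : 0 < δ)
    {f : X → Y} {h : Y → X} (hf : ∀ x, c x (f x) ≤ δ) (hh : ∀ y, c (h y) y ≤ δ)
    (hequiv : ∀ g y, c (μ g (h y)) (ν g y) ≤ δ) :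
    ∃ d : X ⊕ Y → X ⊕ Y → ℝ, Admissible μ ν d ∧
      (∀ x, ∃ y, d (.inl x) (.inr y) ≤ 4 * δ) ∧ ∀ y, ∃ x, d (.inl x) (.inr y) ≤ 4 * δ := by
  refine ⟨sumDist fun x y => δ + ⨆ g, c (μ g x) (ν g y),
    (hc.iSup_translate hμ hν hδ.le).admissible_sumDist hμ hν
      (fun k x y => by rw [iSup_translate_map hμ hν]) fun x y => ?_,
    fun x => ⟨f x, ?_⟩, fun y => ⟨h y, ?_⟩⟩
  · exact add_pos_of_pos_of_nonneg hδ (Real.iSup_nonneg fun g => hc.nonneg _ _)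
  · have : ⨆ g, c (μ g x) (ν g (f x)) ≤ 3 * δ := ciSup_le fun g => by
      have h₁ := hc.le_left (μ g x) (μ g (h (f x))) (ν g (f x))
      rw [hμ.2.2] at h₁
      linarith [hc.dist_left x (h (f x)) (f x), hf x, hh (f x), hequiv g (f x)]
    simp only [sumDist]
    linarith
  · have : ⨆ g, c (μ g (h y)) (ν g y) ≤ δ := ciSup_le fun g => hequiv g y
    simp only [sumDist]
    linarith

end Basic

theorem exists_of_ghDist_lt {X Y : Type*} [MetricSpace X] [CompactSpace X] [Nonempty X]
    [MetricSpace Y] [CompactSpace Y] [Nonempty Y] {ε : ℝ} (hε : GromovHausdorff.ghDist X Y < ε) :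
    ∃ c : X → Y → ℝ, IsCoupling c ∧ (∀ x, ∃ y, c x y ≤ ε) ∧ ∀ y, ∃ x, c x y ≤ ε := by
  obtain ⟨Φ, Ψ, hΦ, hΨ, h⟩ := GromovHausdorff.ghDist_eq_hausdorffDist X Y
  rw [h] at hε
  have hfin : hausdorffEDist (Set.range Φ) (Set.range Ψ) ≠ ⊤ :=
    hausdorffEDist_ne_top_of_nonempty_of_bounded (Set.range_nonempty _) (Set.range_nonempty _)
      (isCompact_range hΦ.continuous).isBounded (isCompact_range hΨ.continuous).isBounded
  refine ⟨fun x y => dist (Φ x) (Ψ y), ⟨fun x x' y => ?_, fun x y y' => ?_, fun x x' y => ?_,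
    fun x y y' => ?_⟩, fun x => ?_, fun y => ?_⟩
  · rw [← hΦ.dist_eq]
    exact dist_triangle _ _ _
  · rw [← hΨ.dist_eq]
    exact dist_triangle _ _ _
  · rw [← hΦ.dist_eq]
    exact dist_triangle_right _ _ _
  · rw [← hΨ.dist_eq]
    exact dist_triangle_left _ _ _
  · obtain ⟨_, ⟨y, rfl⟩, hy⟩ := exists_dist_lt_of_hausdorffDist_lt (Set.mem_range_self x) hε hfin
    exact ⟨y, hy.le⟩
  · obtain ⟨_, ⟨x, rfl⟩, hx⟩ := exists_dist_lt_of_hausdorffDist_lt' (Set.mem_range_self y) hε hfin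
    exact ⟨x, hx.le⟩

section Limit

variable {ι : Type*} {l : Ultrafilter ι} {X : ι → Type*} [∀ i, MetricSpace (X i)]
  {Y : Type*} [MetricSpace Y] {c : ∀ i, X i → Y → ℝ}

theorem tendsto_dist_left (hc : ∀ i, IsCoupling (c i)) {x x' : ∀ i, X i} {y : Y}
    (hx : Tendsto (fun i => c i (x i) y) l (nhds 0))
    (hx' : Tendsto (fun i => c i (x' i) y) l (nhds 0)) :
    Tendsto (fun i => dist (x i) (x' i)) l (nhds 0) :=
  squeeze_zero (fun _ => dist_nonneg) (fun i => (hc i).dist_left _ _ y)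
    (by simpa using hx.add hx')

theorem tendsto_of_dist (hc : ∀ i, IsCoupling (c i)) {x x' : ∀ i, X i} {y : Y}
    (hx : Tendsto (fun i => c i (x i) y) l (nhds 0))
    (hx' : Tendsto (fun i => dist (x' i) (x i)) l (nhds 0)) :
    Tendsto (fun i => c i (x' i) y) l (nhds 0) :=
  squeeze_zero (fun i => (hc i).nonneg _ _) (fun i => (hc i).le_left _ _ y)
    (by simpa using hx'.add hx)

theorem tendsto_dist (hc : ∀ i, IsCoupling (c i)) {x x' : ∀ i, X i} {y y' : Y}
    (hx : Tendsto (fun i => c i (x i) y) l (nhds 0))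
    (hx' : Tendsto (fun i => c i (x' i) y') l (nhds 0)) :
    Tendsto (fun i => dist (x i) (x' i)) l (nhds (dist y y')) := by
  refine tendsto_iff_dist_tendsto_zero.2 (squeeze_zero (fun _ => dist_nonneg) (fun i => ?_)
    (by simpa using hx.add hx'))
  have h₁ := (hc i).dist_left (x i) (x' i) y
  have h₂ := (hc i).le_right (x' i) y y'
  have h₃ := (hc i).dist_right (x i) y y'
  have h₄ := (hc i).le_left (x i) (x' i) y'
  rw [dist_comm y' y] at h₂
  rw [Real.dist_eq, abs_le]
  constructor <;> linarith

theorem limit_unique (hc : ∀ i, IsCoupling (c i)) {x : ∀ i, X i} {y y' : Y}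
    (hx : Tendsto (fun i => c i (x i) y) l (nhds 0))
    (hx' : Tendsto (fun i => c i (x i) y') l (nhds 0)) : y = y' := by
  have h := tendsto_dist hc hx hx'
  simp only [dist_self] at h
  exact dist_eq_zero.1 (tendsto_nhds_unique h tendsto_const_nhds)

theorem exists_limit [CompactSpace Y] (hc : ∀ i, IsCoupling (c i)) {f : ∀ i, X i → Y} {ε : ι → ℝ}
    (hε : Tendsto ε l (nhds 0)) (hf : ∀ i x, c i x (f i x) ≤ ε i) (x : ∀ i, X i) :
    ∃ y, Tendsto (fun i => c i (x i) y) l (nhds 0) := by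
  obtain ⟨y, -, hy⟩ := isCompact_univ.ultrafilter_le_nhds (l.map fun i => f i (x i)) (by simp)
  refine ⟨y, squeeze_zero (fun i => (hc i).nonneg _ _)
    (fun i => ((hc i).le_right _ _ (f i (x i))).trans (add_le_add_left (hf i _) _)) ?_⟩
  simpa using hε.add (tendsto_iff_dist_tendsto_zero.1 hy)

/-- Isometric actions on spaces converging to a compact space `Y` along an ultrafilter induce a
limit action on `Y`, and the convergence is uniform. -/
theorem exists_limit_action {G : Type*} [Monoid G] [Finite G] {μ : ∀ i, G → X i → X i}
    (hμ : ∀ i, IsIsoAction (μ i)) [CompactSpace Y] (hc : ∀ i, IsCoupling (c i))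
    {f : ∀ i, X i → Y} {h : ∀ i, Y → X i} {ε : ι → ℝ} (hε : Tendsto ε l (nhds 0))
    (hf : ∀ i x, c i x (f i x) ≤ ε i) (hh : ∀ i y, c i (h i y) y ≤ ε i) :
    ∃ ν : G → Y → Y, IsIsoAction ν ∧
      ∀ δ > 0, ∀ᶠ i in l, ∀ g y, c i (μ i g (h i y)) (ν g y) ≤ δ := by
  have hlim : ∀ y, Tendsto (fun i => c i (h i y) y) l (nhds 0) := fun y =>
    squeeze_zero (fun i => (hc i).nonneg _ _) (fun i => hh i y) hε
  choose ν hν using fun (g : G) (y : Y) => exists_limit hc hε hf fun i => μ i g (h i y)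
  have hmap : ∀ (g : G) {x : ∀ i, X i} {y : Y}, Tendsto (fun i => c i (x i) y) l (nhds 0) →
      Tendsto (fun i => c i (μ i g (x i)) (ν g y)) l (nhds 0) := fun g x y hx =>
    tendsto_of_dist hc (hν g y) (by
      simpa only [(hμ _).2.2] using tendsto_dist_left hc hx (hlim y))
  have hiso : ∀ g y y', dist (ν g y) (ν g y') = dist y y' := fun g y y' =>
    tendsto_nhds_unique (tendsto_dist hc (hν g y) (hν g y')) (by
      simpa only [(hμ _).2.2] using tendsto_dist hc (hlim y) (hlim y'))
  refine ⟨ν, ⟨fun y => limit_unique hc (hν 1 y) (by simpa only [(hμ _).1] using hlim y),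
    fun g g' y => limit_unique hc (hν (g * g') y) (by
      simpa only [(hμ _).2.1] using hmap g (hν g' y)), hiso⟩, fun δ hδ => ?_⟩
  obtain ⟨t, -, ht, hcover⟩ := finite_cover_balls_of_compact (isCompact_univ (X := Y))
    (show 0 < δ / 5 by positivity)
  have hnet : ∀ᶠ i in l, ∀ g, ∀ y ∈ t, c i (μ i g (h i y)) (ν g y) < δ / 5 :=
    eventually_all.2 fun g => (eventually_all_finite ht).2 fun y _ =>
      (hν g y).eventually_lt_const (by positivity)
  filter_upwards [hnet, hε.eventually_lt_const (show 0 < δ / 5 by positivity)] with i hi hεi g y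
  obtain ⟨z, hz, hyz⟩ := Set.mem_iUnion₂.1 (hcover (Set.mem_univ y))
  rw [mem_ball] at hyz
  have h₁ := (hc i).le_left (μ i g (h i y)) (μ i g (h i z)) (ν g y)
  have h₂ := (hc i).le_right (μ i g (h i z)) (ν g y) (ν g z)
  have h₃ := (hc i).dist_left (h i y) (h i z) z
  have h₄ := (hc i).le_right (h i y) z y
  rw [(hμ i).2.2] at h₁
  rw [hiso, dist_comm] at h₂
  linarith [hi g z hz, hh i y, hh i z]

end Limit

end IsCoupling

theorem iSup_iInf_mem_Icc {α β : Type*} [Nonempty α] {u : α → β → ℝ} {r : ℝ}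
    (h₀ : ∀ a b, 0 ≤ u a b) (h : ∀ a, ∃ b, u a b ≤ r) :
    ⨆ a, ⨅ b, u a b ∈ Set.Icc 0 r := by
  refine ⟨Real.iSup_nonneg fun a => Real.iInf_nonneg (h₀ a), ciSup_le fun a => ?_⟩
  obtain ⟨b, hb⟩ := h a
  exact (ciInf_le ⟨0, Set.forall_mem_range.2 (h₀ a)⟩ b).trans hb

/-- In the setting of equivariant convergence, additionally the
quotients converge: with `Dᵢ(a,b) = min_{g∈G} dᵢ(a, g·b)`, both one-sided Hausdorff
quantities between `X_{φ(i)}` and `Y` with respect to `Dᵢ` tend to `0`, i.e.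
`G\X_{φ(i)} → G\Y` in the Gromov--Hausdorff sense. -/
theorem stmt8 (G : Type*) [Group G] [Fintype G]
    (X : ℕ → Type u) [∀ i, MetricSpace (X i)]
    [∀ i, CompactSpace (X i)] [∀ i, Nonempty (X i)]
    (μ : ∀ i, G → X i → X i) (hμ : ∀ i, IsIsoAction (μ i))
    (Y : Type v) [MetricSpace Y] [CompactSpace Y] [Nonempty Y]
    (hconv : Tendsto (fun i => GromovHausdorff.ghDist (X i) Y) atTop (nhds 0)) :
    ∃ ν : G → Y → Y, IsIsoAction ν ∧
      ∃ φ : ℕ → ℕ, StrictMono φ ∧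
      ∃ d : (i : ℕ) → (X (φ i) ⊕ Y) → (X (φ i) ⊕ Y) → ℝ,
        (∀ i, Admissible (μ (φ i)) ν (d i)) ∧
        Tendsto (fun i => hDist (d i)) atTop (nhds 0) ∧
        Tendsto (fun i => ⨆ x : X (φ i), ⨅ y : Y, ⨅ g : G,
            d i (Sum.inl x) (Sum.map (μ (φ i) g) (ν g) (Sum.inr y))) atTop (nhds 0) ∧
        Tendsto (fun i => ⨆ y : Y, ⨅ x : X (φ i), ⨅ g : G,
            d i (Sum.inl x) (Sum.map (μ (φ i) g) (ν g) (Sum.inr y))) atTop (nhds 0) := by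
  have hlt : ∀ i, GromovHausdorff.ghDist (X i) Y <
      GromovHausdorff.ghDist (X i) Y + 1 / ((i : ℝ) + 1) := fun i =>
    lt_add_of_pos_right _ Nat.one_div_pos_of_nat
  have hε : Tendsto (fun i : ℕ => GromovHausdorff.ghDist (X i) Y + 1 / ((i : ℝ) + 1))
      atTop (nhds 0) := by
    simpa using hconv.add tendsto_one_div_add_atTop_nhds_zero_nat
  choose c hc f' h' using fun i => IsCoupling.exists_of_ghDist_lt (hlt i)
  choose f hf using f'
  choose h hh using h'
  obtain ⟨ν, hν, hunif⟩ := IsCoupling.exists_limit_action (l := hyperfilter ℕ) hμ hc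
    (hε.mono_left Nat.hyperfilter_le_atTop) hf hh
  have hδ : ∀ n : ℕ, (0 : ℝ) < 1 / ((n : ℝ) + 1) := fun n => Nat.one_div_pos_of_nat
  obtain ⟨φ, hφ, hφδ⟩ := extraction_forall_of_frequently fun n : ℕ =>
    (((hunif _ (hδ n)).and ((hε.mono_left Nat.hyperfilter_le_atTop).eventually_le_const
      (hδ n))).frequently.filter_mono Nat.hyperfilter_le_atTop)
  choose d hd hdX hdY using fun n => (hc (φ n)).exists_admissible (hμ (φ n)) hν (hδ n)
    (fun x => (hf (φ n) x).trans (hφδ n).2) (fun y => (hh (φ n) y).trans (hφδ n).2) (hφδ n).1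
  have hr : Tendsto (fun n : ℕ => 4 * (1 / ((n : ℝ) + 1))) atTop (nhds 0) := by
    simpa using tendsto_one_div_add_atTop_nhds_zero_nat.const_mul (4 : ℝ)
  have key : ∀ u : ℕ → ℝ, (∀ n : ℕ, u n ∈ Set.Icc 0 (4 * (1 / ((n : ℝ) + 1)))) →
      Tendsto u atTop (nhds 0) := fun u hu =>
    squeeze_zero (fun n => (hu n).1) (fun n => (hu n).2) hr
  have hpos : ∀ n x y, 0 ≤ d n (.inl x) (.inr y) := fun n x y => ((hd n).2.2.2.2.2 x y).le
  have hquot : ∀ n x y, ⨅ g : G, d n (.inl x) (Sum.map (μ (φ n) g) (ν g) (.inr y)) ≤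
      d n (.inl x) (.inr y) := fun n x y => by
    refine (ciInf_le (Set.finite_range _).bddBelow 1).trans_eq ?_
    simp only [Sum.map_inr, hν.1]
  have hquot₀ : ∀ n x y, 0 ≤ ⨅ g : G, d n (.inl x) (Sum.map (μ (φ n) g) (ν g) (.inr y)) :=
    fun n x y => Real.iInf_nonneg fun g => hpos n x _
  refine ⟨ν, hν, φ, hφ, d, hd, key _ fun n => ?_, key _ fun n => ?_, key _ fun n => ?_⟩
  · have h₁ := iSup_iInf_mem_Icc (hpos n) (hdX n)
    have h₂ := iSup_iInf_mem_Icc (fun y x => hpos n x y) (hdY n)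
    exact ⟨h₁.1.trans (le_max_left _ _), max_le h₁.2 h₂.2⟩
  · exact iSup_iInf_mem_Icc (hquot₀ n) fun x =>
      (hdX n x).imp fun y hy => (hquot n x y).trans hy
  · exact iSup_iInf_mem_Icc (fun y x => hquot₀ n x y) fun y =>
      (hdY n y).imp fun x hx => (hquot n x y).trans hx
end
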